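/- arXiv:1606.01848 — 2 statements merged into one kernel-verified Lean document; each statement's English description precedes it below -/
import Mathlib

section
/- The graph Ci₁₁(1,2,3)∖{v} admits a faithful orthogonal representation in ℂ⁶; combined with the nonexistence of such a representation in ℂ⁵, Ξ(Ci₁₁(1,2,3)∖{v}) = 6. -/
open Module

/-- An orthogonal representation (OR) of a simple graph `G` in `ℂ^d`: an injective map from the
vertices of `G` to one-dimensional subspaces of `ℂ^d` such that adjacent vertices are mapped to
orthogonal subspaces. -/
def IsOrthRep {V : Type*} (G : SimpleGraph V) (d : ℕ)
    (φ : V → Submodule ℂ (EuclideanSpace ℂ (Fin d))) : Prop :=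
  Function.Injective φ ∧ (∀ v, Module.finrank ℂ (φ v) = 1) ∧
    ∀ u v : V, G.Adj u v → φ u ≤ (φ v)ᗮ

/-- A faithful orthogonal representation (FOR) of a simple graph `G` in `ℂ^d`: an injective map
from the vertices of `G` to one-dimensional subspaces of `ℂ^d` such that two distinct vertices
are adjacent if and only if their images are orthogonal subspaces. -/
def IsFaithfulOrthRep {V : Type*} (G : SimpleGraph V) (d : ℕ)
    (φ : V → Submodule ℂ (EuclideanSpace ℂ (Fin d))) : Prop :=
  Function.Injective φ ∧ (∀ v, Module.finrank ℂ (φ v) = 1) ∧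
    ∀ u v : V, u ≠ v → (G.Adj u v ↔ φ u ≤ (φ v)ᗮ)

/-- `G` admits an orthogonal representation in `ℂ^d`. -/
def HasOR {V : Type*} (G : SimpleGraph V) (d : ℕ) : Prop := ∃ φ, IsOrthRep G d φ

/-- `G` admits a faithful orthogonal representation in `ℂ^d`. -/
def HasFOR {V : Type*} (G : SimpleGraph V) (d : ℕ) : Prop := ∃ φ, IsFaithfulOrthRep G d φ

/-- `ξ(G)`: the smallest dimension `d` such that `G` admits an orthogonal representation
in `ℂ^d`. -/
noncomputable def xi {V : Type*} (G : SimpleGraph V) : ℕ := sInf {d | HasOR G d}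

/-- `Ξ(G)`: the smallest dimension `d` such that `G` admits a faithful orthogonal representation
in `ℂ^d`. -/
noncomputable def Xi {V : Type*} (G : SimpleGraph V) : ℕ := sInf {d | HasFOR G d}

/-- A `b`-fold coloring of `G` with `a` colors: each vertex receives a set of `b` colors out of
`a` colors such that adjacent vertices receive disjoint sets. -/
def HasFoldColoring {V : Type*} (G : SimpleGraph V) (a b : ℕ) : Prop :=
  ∃ c : V → Finset (Fin a), (∀ v, (c v).card = b) ∧
    ∀ u v : V, G.Adj u v → Disjoint (c u) (c v)

/-- The fractional chromatic number `χ_f(G)`: the infimum of `a / b` over all `b`-fold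
colorings of `G` with `a` colors. -/
noncomputable def fracChrom {V : Type*} (G : SimpleGraph V) : ℝ :=
  sInf {x : ℝ | ∃ a b : ℕ, 0 < b ∧ HasFoldColoring G a b ∧ x = (a : ℝ) / b}

/-- The join `G₁ + G₂` of two graphs: their disjoint union together with one additional edge
between every pair of vertices taken one from each graph. -/
def graphJoin {V₁ V₂ : Type*} (G₁ : SimpleGraph V₁) (G₂ : SimpleGraph V₂) :
    SimpleGraph (V₁ ⊕ V₂) :=
  (G₁ ⊕g G₂) ⊔ completeBipartiteGraph V₁ V₂

open scoped ComplexConjugate InnerProductSpace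

section LowerBound

variable {E : Type*} [NormedAddCommGroup E] [InnerProductSpace ℂ E]

/-- Four orthonormal vectors together with a fifth vector orthogonal to the last three, and not a
multiple of the first, give rise to an orthonormal family of five vectors. -/
lemma exists_orthonormal_five {p q r s t : E} (h : Orthonormal ℂ ![p, q, r, s])
    (hq : ⟪q, t⟫_ℂ = 0) (hr : ⟪r, t⟫_ℂ = 0) (hs : ⟪s, t⟫_ℂ = 0) (hpar : ∀ c : ℂ, t ≠ c • p) :
    ∃ w, Orthonormal ℂ ![p, q, r, s, w] := by
  have hij := orthonormal_iff_ite.mp h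
  simp [-inner_self_eq_norm_sq_to_K, Fin.forall_fin_succ] at hij
  set y := t - ⟪p, t⟫_ℂ • p with hy
  have hy0 : y ≠ 0 := sub_ne_zero.mpr (hpar _)
  have hself : ⟪(‖y‖⁻¹ : ℂ) • y, (‖y‖⁻¹ : ℂ) • y⟫_ℂ = 1 := by
    simp [norm_smul, hy0]
  have hright {z : E} (hz : ⟪z, y⟫_ℂ = 0) :
      ⟪z, (‖y‖⁻¹ : ℂ) • y⟫_ℂ = 0 ∧ ⟪(‖y‖⁻¹ : ℂ) • y, z⟫_ℂ = 0 := by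
    rw [← inner_eq_zero_symm (x := z), inner_smul_right, hz, mul_zero, and_self]
  have h₁ := hright (z := p) (by simp [-inner_self_eq_norm_sq_to_K, hy, hij])
  have h₂ := hright (z := q) (by simp [hy, hij, hq])
  have h₃ := hright (z := r) (by simp [hy, hij, hr])
  have h₄ := hright (z := s) (by simp [hy, hij, hs])
  refine ⟨(‖y‖⁻¹ : ℂ) • y, orthonormal_iff_ite.mpr ?_⟩
  generalize (‖y‖⁻¹ : ℂ) • y = w at *
  simp [-inner_self_eq_norm_sq_to_K, Fin.forall_fin_succ, hij, h₁, h₂, h₃, h₄, hself]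

/-- In dimension at most `5`, a unit vector `t` orthogonal to three members of an orthonormal
family `p, q, r, s, w` is a combination of the other two, and replacing `p` by `t` completes to
a new orthonormal family. -/
lemma Orthonormal.exchange_five [FiniteDimensional ℂ E] (hE : finrank ℂ E ≤ 5)
    {p q r s w t : E} (h : Orthonormal ℂ ![p, q, r, s, w]) (ht : ⟪t, t⟫_ℂ = 1)
    (hq : ⟪q, t⟫_ℂ = 0) (hr : ⟪r, t⟫_ℂ = 0) (hs : ⟪s, t⟫_ℂ = 0) (hp : ⟪p, t⟫_ℂ ≠ 0)
    (hpar : ∀ c : ℂ, t ≠ c • p) :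
    ∃ (a b : ℂ) (w' : E), a ≠ 0 ∧ b ≠ 0 ∧ a * conj a + b * conj b = 1 ∧ t = a • p + b • w ∧
      w' = conj b • p - conj a • w ∧ Orthonormal ℂ ![q, r, s, t, w'] := by
  have hspan : Submodule.span ℂ (Set.range ![p, q, r, s, w]) = ⊤ := by
    apply Submodule.eq_top_of_finrank_eq
    have := finrank_span_eq_card h.linearIndependent
    have := Submodule.finrank_le (Submodule.span ℂ (Set.range ![p, q, r, s, w]))
    simp only [Fintype.card_fin] at *
    omega
  have hexp := (OrthonormalBasis.mk h hspan.ge).sum_repr' t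
  simp only [OrthonormalBasis.coe_mk, Fin.sum_univ_five] at hexp
  simp only [Matrix.cons_val, hq, hr, hs, zero_smul, add_zero] at hexp
  have hij := orthonormal_iff_ite.mp h
  simp [-inner_self_eq_norm_sq_to_K, Fin.forall_fin_succ] at hij
  set a := ⟪p, t⟫_ℂ
  set b := ⟪w, t⟫_ℂ
  have hab : a * conj a + b * conj b = 1 := by
    rw [← ht, ← hexp]
    simp [-inner_self_eq_norm_sq_to_K, hij]
  have hb : b ≠ 0 := fun hb => hpar a (by rw [← hexp, hb]; simp)
  refine ⟨a, b, _, hp, hb, hab, hexp.symm, rfl, orthonormal_iff_ite.mpr ?_⟩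
  rw [← hexp]
  simp [-inner_self_eq_norm_sq_to_K, Fin.forall_fin_succ, inner_add_left, inner_add_right,
    inner_sub_left, inner_sub_right, inner_smul_left, inner_smul_right, hij]
  refine ⟨⟨?_, ?_⟩, ?_, ?_⟩
  · linear_combination hab
  · ring
  · ring
  · linear_combination hab

/-- There is no family of unit vectors in dimension at most `5`, indexed by the nonzero residues
modulo `11` and pairwise nonparallel, whose orthogonality graph is `Ci₁₁(1,2,3) ∖ {0}`. -/
lemma not_orthogonality_circulant_of_finrank_le_five [FiniteDimensional ℂ E]
    (hE : finrank ℂ E ≤ 5) (u : ZMod 11 → E) (hu : ∀ i ≠ 0, ⟪u i, u i⟫_ℂ = 1)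
    (hpar : ∀ i ≠ 0, ∀ j ≠ 0, i ≠ j → ∀ c : ℂ, u i ≠ c • u j)
    (horth : ∀ i ≠ 0, ∀ j ≠ 0, i ≠ j →
      ((SimpleGraph.circulantGraph ({1, 2, 3} : Set (ZMod 11))).Adj i j ↔ ⟪u i, u j⟫_ℂ = 0)) :
    False := by
  have adj {i j : ZMod 11} (h : i ≠ 0 ∧ j ≠ 0 ∧ i ≠ j ∧ (i - j ∈ ({1, 2, 3} : Finset (ZMod 11)) ∨
      j - i ∈ ({1, 2, 3} : Finset (ZMod 11)))) : ⟪u i, u j⟫_ℂ = 0 :=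
    (horth i h.1 j h.2.1 h.2.2.1).mp (by
      simpa [SimpleGraph.circulantGraph_adj, h.2.2.1] using h.2.2.2)
  have nadj {i j : ZMod 11} (h : i ≠ 0 ∧ j ≠ 0 ∧ i ≠ j ∧ i - j ∉ ({1, 2, 3} : Finset (ZMod 11)) ∧
      j - i ∉ ({1, 2, 3} : Finset (ZMod 11))) : ⟪u i, u j⟫_ℂ ≠ 0 := fun h0 => by
    have := (horth i h.1 j h.2.1 h.2.2.1).mpr h0
    have h' := h.2.2.2
    simp [SimpleGraph.circulantGraph_adj, h.2.2.1] at this h'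
    tauto
  have h0 : Orthonormal ℂ ![u 1, u 2, u 3, u 4] := by
    rw [orthonormal_iff_ite]
    simp [-inner_self_eq_norm_sq_to_K, Fin.forall_fin_succ, hu 1 (by decide), hu 2 (by decide),
      hu 3 (by decide), hu 4 (by decide), adj (i := 1) (j := 2) (by decide),
      adj (i := 1) (j := 3) (by decide), adj (i := 1) (j := 4) (by decide),
      adj (i := 2) (j := 1) (by decide), adj (i := 2) (j := 3) (by decide),
      adj (i := 2) (j := 4) (by decide), adj (i := 3) (j := 1) (by decide),
      adj (i := 3) (j := 2) (by decide), adj (i := 3) (j := 4) (by decide),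
      adj (i := 4) (j := 1) (by decide), adj (i := 4) (j := 2) (by decide),
      adj (i := 4) (j := 3) (by decide)]
  have par {i j : ZMod 11} (h : i ≠ 0 ∧ j ≠ 0 ∧ i ≠ j) : ∀ c : ℂ, u i ≠ c • u j :=
    hpar i h.1 j h.2.1 h.2.2
  obtain ⟨w₁, h₁⟩ := exists_orthonormal_five h0 (t := u 5) (adj (by decide)) (adj (by decide))
    (adj (by decide)) (par (by decide))
  have exch {k l m n o : ZMod 11} {w : E} (h : Orthonormal ℂ ![u k, u l, u m, u n, w])
      (hl : ⟪u l, u o⟫_ℂ = 0) (hm : ⟪u m, u o⟫_ℂ = 0) (hn : ⟪u n, u o⟫_ℂ = 0)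
      (hk : ⟪u k, u o⟫_ℂ ≠ 0) (hko : o ≠ 0 ∧ k ≠ 0 ∧ o ≠ k) :=
    h.exchange_five hE (hu o hko.1) hl hm hn hk (par hko)
  obtain ⟨a₁, b₁, w₂, -, hb₁, -, e₁, f₁, h₂⟩ := exch (o := 5) h₁ (adj (by decide))
    (adj (by decide)) (adj (by decide)) (nadj (by decide)) (by decide)
  obtain ⟨a₂, b₂, w₃, ha₂, -, -, e₂, f₂, h₃⟩ := exch (o := 6) h₂ (adj (by decide))
    (adj (by decide)) (adj (by decide)) (nadj (by decide)) (by decide)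
  obtain ⟨a₃, b₃, w₄, ha₃, -, -, -, f₃, h₄⟩ := exch (o := 7) h₃ (adj (by decide))
    (adj (by decide)) (adj (by decide)) (nadj (by decide)) (by decide)
  obtain ⟨a₄, b₄, w₅, ha₄, -, -, -, f₄, h₅⟩ := exch (o := 8) h₄ (adj (by decide))
    (adj (by decide)) (adj (by decide)) (nadj (by decide)) (by decide)
  obtain ⟨a₅, b₅, w₆, -, -, n₅, e₅, f₅, h₆⟩ := exch (o := 9) h₅ (adj (by decide))
    (adj (by decide)) (adj (by decide)) (nadj (by decide)) (by decide)
  obtain ⟨a₆, b₆, -, -, hb₆, -, e₆, -, -⟩ := exch (o := 10) h₆ (adj (by decide))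
    (adj (by decide)) (adj (by decide)) (nadj (by decide)) (by decide)
  have u₁₁ := hu 1 (by decide)
  have u₂₂ := hu 2 (by decide)
  have u₁₂ := adj (i := 1) (j := 2) (by decide)
  have u₁₃ := adj (i := 1) (j := 3) (by decide)
  have u₁₄ := adj (i := 1) (j := 4) (by decide)
  have u₂₃ := adj (i := 2) (j := 3) (by decide)
  have u₂₄ := adj (i := 2) (j := 4) (by decide)
  have u₂₅ := adj (i := 2) (j := 5) (by decide)
  have x₁ : ⟪u 1, w₁⟫_ℂ = 0 := h₁.inner_eq_zero (i := 0) (j := 4) (by decide)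
  have y₂ : ⟪u 2, w₂⟫_ℂ = 0 := h₂.inner_eq_zero (i := 0) (j := 4) (by decide)
  have u₁₅ : ⟪u 1, u 5⟫_ℂ = a₁ := by
    rw [e₁, inner_add_right, inner_smul_right, inner_smul_right, u₁₁, x₁]; ring
  have u₂₆ : ⟪u 2, u 6⟫_ℂ = a₂ := by
    rw [e₂, inner_add_right, inner_smul_right, inner_smul_right, u₂₂, y₂]; ring
  have x₂ : ⟪u 1, w₂⟫_ℂ = conj b₁ := by
    rw [f₁, inner_sub_right, inner_smul_right, inner_smul_right, u₁₁, x₁]; ring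
  have u₁₆ : ⟪u 1, u 6⟫_ℂ = b₂ * conj b₁ := by
    rw [e₂, inner_add_right, inner_smul_right, inner_smul_right, u₁₂, x₂]; ring
  have x₅ : ⟪u 1, w₅⟫_ℂ = - (conj a₄ * conj a₃ * conj a₂ * conj b₁) := by
    simp only [f₄, f₃, f₂, inner_sub_right, inner_smul_right, u₁₂, u₁₃, u₁₄, x₂]; ring
  have y₅ : ⟪u 2, w₅⟫_ℂ = conj a₄ * conj a₃ * conj b₂ := by
    simp only [f₄, f₃, f₂, inner_sub_right, inner_smul_right, u₂₂, u₂₃, u₂₄, y₂]; ring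
  have A := adj (i := 1) (j := 9) (by decide)
  have B := adj (i := 1) (j := 10) (by decide)
  have C := adj (i := 2) (j := 10) (by decide)
  rw [e₅, inner_add_right, inner_smul_right, inner_smul_right, u₁₅, x₅] at A
  rw [e₆, f₅, inner_add_right, inner_smul_right, inner_smul_right, inner_sub_right,
    inner_smul_right, inner_smul_right] at B C
  rw [u₁₆, u₁₅, x₅] at B
  rw [u₂₆, u₂₅, y₅] at C
  have hB : a₅ * a₆ * b₂ + b₆ * (conj a₄ * conj a₃ * conj a₂) = 0 := by
    have hb₁' : conj b₁ ≠ 0 := by simpa using hb₁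
    refine mul_left_cancel₀ hb₁' ?_
    linear_combination a₅ * B - b₆ * conj b₅ * A
      - b₆ * conj a₄ * conj a₃ * conj a₂ * conj b₁ * n₅
  have hC : a₅ * conj a₅ * (b₂ * conj b₂) + a₂ * conj a₂ = 0 := by
    have hne : b₆ * conj a₄ * conj a₃ ≠ 0 := by simp [hb₆, ha₃, ha₄]
    refine mul_left_cancel₀ hne ?_
    linear_combination a₂ * hB - a₅ * b₂ * C
  simp only [Complex.mul_conj] at hC
  norm_cast at hC
  have := Complex.normSq_pos.mpr ha₂
  have := mul_nonneg (Complex.normSq_nonneg a₅) (Complex.normSq_nonneg b₂)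
  linarith

end LowerBound

/-- A one-dimensional subspace is spanned by a unit vector. -/
lemma exists_unit_span_singleton {E : Type*} [NormedAddCommGroup E] [InnerProductSpace ℂ E]
    {L : Submodule ℂ E} (hL : finrank ℂ L = 1) :
    ∃ x : E, ⟪x, x⟫_ℂ = 1 ∧ L = Submodule.span ℂ {x} := by
  obtain ⟨y, hyL, hy⟩ := L.ne_bot_iff.mp (by rintro rfl; simp at hL)
  have hnorm : (‖y‖⁻¹ : ℂ) ≠ 0 := by simpa using hy
  have hx : (‖y‖⁻¹ : ℂ) • y ≠ 0 := smul_ne_zero hnorm hy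
  refine ⟨(‖y‖⁻¹ : ℂ) • y, by simp [norm_smul, hy], ?_⟩
  have := FiniteDimensional.of_finrank_eq_succ hL
  refine (Submodule.eq_of_le_of_finrank_eq ?_ ?_).symm
  · exact (Submodule.span_singleton_le_iff_mem _ _).mpr (L.smul_mem _ hyL)
  · rw [finrank_span_singleton hx, hL]

lemma span_singleton_le_orthogonal_span_singleton_iff {E : Type*} [NormedAddCommGroup E]
    [InnerProductSpace ℂ E] {x y : E} :
    Submodule.span ℂ {x} ≤ (Submodule.span ℂ {y})ᗮ ↔ ⟪x, y⟫_ℂ = 0 := by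
  rw [Submodule.span_singleton_le_iff_mem, Submodule.mem_orthogonal_singleton_iff_inner_left]

/-- Integer vectors in dimension `6` whose orthogonality graph on the nonzero residues modulo `11`
is `Ci₁₁(1,2,3) ∖ {0}`. -/
def circulantVector : ZMod 11 → Fin 6 → ℤ :=
  ![![0, 0, 0, 0, 0, 0],
    ![1, 0, 0, 0, 0, 0],
    ![0, 1, 0, 0, 0, 0],
    ![0, 0, 1, 0, 0, 0],
    ![0, 0, 0, 1, 0, 0],
    ![1, 0, 0, 0, 0, -1],
    ![1, 1, 0, 0, -2, 1],
    ![1, 2, -1, 0, 2, 1],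
    ![2, -2, 2, 1, 1, 2],
    ![0, 1, 1, 2, 0, -1],
    ![0, 0, 1, -1, 1, -1]]

lemma circulantVector_dotProduct : ∀ i ≠ 0, ∀ j ≠ 0, i ≠ j →
    ((i - j ∈ ({1, 2, 3} : Finset (ZMod 11)) ∨ j - i ∈ ({1, 2, 3} : Finset (ZMod 11))) ↔
      circulantVector i ⬝ᵥ circulantVector j = 0) := by
  decide +kernel

lemma circulantVector_separates : ∀ i ≠ 0, ∀ j ≠ 0, i ≠ j →
    ∃ k, circulantVector i ⬝ᵥ circulantVector k = 0 ∧
      circulantVector j ⬝ᵥ circulantVector k ≠ 0 := by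
  decide +kernel

lemma circulantVector_ne_zero : ∀ i ≠ 0, circulantVector i ≠ 0 := by
  decide +kernel

lemma hasFOR_circulant_six (v : ZMod 11) :
    HasFOR ((SimpleGraph.circulantGraph ({1, 2, 3} : Set (ZMod 11))).induce
      {i : ZMod 11 | i ≠ v}) 6 := by
  let x (i : ZMod 11) : EuclideanSpace ℂ (Fin 6) :=
    WithLp.toLp 2 fun k => (circulantVector i k : ℂ)
  have hinner (i j : ZMod 11) : ⟪x i, x j⟫_ℂ = 0 ↔
      circulantVector i ⬝ᵥ circulantVector j = 0 := by
    have : ⟪x i, x j⟫_ℂ = ((circulantVector i ⬝ᵥ circulantVector j : ℤ) : ℂ) := by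
      simp [x, PiLp.inner_apply, dotProduct, mul_comm]
    rw [this, Int.cast_eq_zero]
  refine ⟨fun i => Submodule.span ℂ {x (i - v)}, ?_, fun i => ?_, fun i j hij => ?_⟩
  · intro i j hij
    by_contra hne
    obtain ⟨k, hik, hjk⟩ := circulantVector_separates (i - v) (sub_ne_zero.mpr i.2) (j - v)
      (sub_ne_zero.mpr j.2) (by simpa [Subtype.ext_iff] using hne)
    rw [← hinner, ← span_singleton_le_orthogonal_span_singleton_iff] at hik
    rw [Ne, ← hinner, ← span_singleton_le_orthogonal_span_singleton_iff] at hjk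
    exact hjk (hij.ge.trans hik)
  · refine finrank_span_singleton fun h => circulantVector_ne_zero _ (sub_ne_zero.mpr i.2) ?_
    funext k
    simpa [x] using congrArg (fun y : EuclideanSpace ℂ (Fin 6) => y k) h
  · have hne : (i : ZMod 11) ≠ j := by simpa [Subtype.ext_iff] using hij
    rw [span_singleton_le_orthogonal_span_singleton_iff, hinner, ← circulantVector_dotProduct _
      (sub_ne_zero.mpr i.2) _ (sub_ne_zero.mpr j.2) (by simpa using hne)]
    simp [SimpleGraph.circulantGraph_adj, hne]

lemma six_le_of_hasFOR_circulant {v : ZMod 11} {d : ℕ}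
    (h : HasFOR ((SimpleGraph.circulantGraph ({1, 2, 3} : Set (ZMod 11))).induce
      {i : ZMod 11 | i ≠ v}) d) : 6 ≤ d := by
  obtain ⟨φ, hinj, hdim, horth⟩ := h
  by_contra! hd
  choose x hx hφ using fun i => exists_unit_span_singleton (hdim i)
  have hmem {i : ZMod 11} (hi : i ≠ 0) : i + v ∈ {i : ZMod 11 | i ≠ v} := by simpa using hi
  let u (i : ZMod 11) : EuclideanSpace ℂ (Fin d) :=
    if hi : i ≠ 0 then x ⟨i + v, hmem hi⟩ else 0
  have hu {i : ZMod 11} (hi : i ≠ 0) : u i = x ⟨i + v, hmem hi⟩ := dif_pos hi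
  refine not_orthogonality_circulant_of_finrank_le_five (by simp; omega) u ?_ ?_ ?_
  · intro i hi
    rw [hu hi, hx]
  · intro i hi j hj hij c hc
    rw [hu hi, hu hj] at hc
    have hc0 : c ≠ 0 := by
      rintro rfl
      simpa [hc] using hx ⟨i + v, hmem hi⟩
    have := hinj (a₁ := ⟨i + v, hmem hi⟩) (a₂ := ⟨j + v, hmem hj⟩) (by
      rw [hφ, hφ ⟨j + v, _⟩, hc, Submodule.span_singleton_smul_eq hc0.isUnit])
    exact hij (by simpa using this)
  · intro i hi j hj hij
    rw [hu hi, hu hj, ← span_singleton_le_orthogonal_span_singleton_iff, ← hφ, ← hφ,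
      ← horth _ _ (by simpa using hij), SimpleGraph.induce_adj]
    exact SimpleGraph.circulantGraph_adj_translate.symm

/-- The graph `Ci₁₁(1,2,3) ∖ {v}` admits a faithful orthogonal representation
in `ℂ⁶`, and `Ξ(Ci₁₁(1,2,3) ∖ {v}) = 6`. -/
theorem stmt16 (v : ZMod 11) :
    HasFOR ((SimpleGraph.circulantGraph ({1, 2, 3} : Set (ZMod 11))).induce
      {i : ZMod 11 | i ≠ v}) 6 ∧
    Xi ((SimpleGraph.circulantGraph ({1, 2, 3} : Set (ZMod 11))).induce
      {i : ZMod 11 | i ≠ v}) = 6 := by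
  exact ⟨hasFOR_circulant_six v, le_antisymm (Nat.sInf_le (hasFOR_circulant_six v))
    (le_csInf ⟨6, hasFOR_circulant_six v⟩ fun _ => six_le_of_hasFOR_circulant)⟩
end

section
/- Let H̄ denote the complement of the 6-vertex graph H = P₂^{2,2}, where H consists of an edge {u,w} together with two pendant leaves attached to u and two pendant leaves attached to w. Then Ξ(H̄) = 5: H̄ admits a faithful orthogonal representation in ℂ⁵ but none in ℂ⁴. -/
open Module

/-- The 6-vertex tree `H = P₂^{2,2}`: the edge `{0, 1}` together with two leaves `2, 3`
attached to `0` and two leaves `4, 5` attached to `1`. -/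
def graphH : SimpleGraph (Fin 6) :=
  SimpleGraph.fromRel (fun a b =>
    (a = 0 ∧ b = 1) ∨ (a = 0 ∧ b = 2) ∨ (a = 0 ∧ b = 3) ∨ (a = 1 ∧ b = 4) ∨ (a = 1 ∧ b = 5))

/-- A faithful orthogonal representation gives unit vectors whose orthogonality relation is
adjacency. -/
theorem IsFaithfulOrthRep.exists_unit_vectors {V : Type*} {G : SimpleGraph V} {d : ℕ}
    {φ : V → Submodule ℂ (EuclideanSpace ℂ (Fin d))} (h : IsFaithfulOrthRep G d φ) :
    ∃ x : V → EuclideanSpace ℂ (Fin d), (∀ v, ‖x v‖ = 1) ∧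
      ∀ u v, u ≠ v → (G.Adj u v ↔ inner ℂ (x u) (x v) = 0) := by
  obtain ⟨-, hrank, hadj⟩ := h
  have key (v : V) : ∃ x, ‖x‖ = 1 ∧ φ v = Submodule.span ℂ {x} := by
    obtain ⟨⟨y, hy⟩, hy0, hspan⟩ := finrank_eq_one_iff'.mp (hrank v)
    have hne : y ≠ 0 := fun h0 => hy0 (Subtype.ext h0)
    refine ⟨((‖y‖ : ℂ)⁻¹) • y, norm_smul_inv_norm hne, ?_⟩
    rw [Submodule.span_singleton_smul_eq (by simpa using hne)]
    refine le_antisymm (fun z hz => ?_) ((Submodule.span_singleton_le_iff_mem _ _).2 hy)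
    obtain ⟨c, hc⟩ := hspan ⟨z, hz⟩
    exact Submodule.mem_span_singleton.2 ⟨c, congrArg Subtype.val hc⟩
  choose x hx hφ using key
  refine ⟨x, hx, fun u v huv => ?_⟩
  rw [hadj u v huv, hφ u, hφ v, ← Submodule.isOrtho_iff_le, Submodule.isOrtho_span]
  simp

/-- Pairwise nonproportional vectors with integer coordinates whose orthogonality relation is
adjacency give a faithful orthogonal representation. -/
theorem HasFOR.of_int_vectors {V : Type*} {G : SimpleGraph V} {d : ℕ} (A : V → Fin d → ℤ)
    (hne : ∀ v, A v ≠ 0)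
    (hinj : ∀ u v, (∀ i j, A u i * A v j = A u j * A v i) → u = v)
    (hadj : ∀ u v, u ≠ v → (G.Adj u v ↔ ∑ i, A v i * A u i = 0)) : HasFOR G d := by
  let x : V → EuclideanSpace ℂ (Fin d) := fun v => WithLp.toLp 2 fun i => (A v i : ℂ)
  refine ⟨fun v => Submodule.span ℂ {x v}, fun u v huv => hinj u v fun i j => ?_,
    fun v => finrank_span_singleton fun h0 => hne v ?_, fun u v huv => ?_⟩
  · have hu : x u ∈ Submodule.span ℂ {x v} := by
      rw [← show Submodule.span ℂ {x u} = Submodule.span ℂ {x v} from huv]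
      exact Submodule.mem_span_singleton_self _
    obtain ⟨c, hc⟩ := Submodule.mem_span_singleton.1 hu
    have hcoord (k : Fin d) : c * (A v k : ℂ) = A u k := congrArg (fun z => z k) hc
    have : (A u i * A v j : ℂ) = A u j * A v i := by
      rw [← hcoord i, ← hcoord j]; ring
    exact_mod_cast this
  · funext i
    have : (A v i : ℂ) = 0 := congrArg (fun z => z i) h0
    exact_mod_cast this
  · have hinner : inner ℂ (x u) (x v) = ((∑ i, A v i * A u i : ℤ) : ℂ) := by
      simp [x, PiLp.inner_apply]
    rw [hadj u v huv, ← Submodule.isOrtho_iff_le, Submodule.isOrtho_span]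
    simp only [Set.mem_singleton_iff, forall_eq, hinner, Int.cast_eq_zero]

instance : DecidableRel graphH.Adj := fun a b => by
  unfold graphH; infer_instance

theorem hasFOR_compl_graphH : HasFOR graphHᶜ 5 :=
  .of_int_vectors
    ![![1, 1, 1, 0, 0], ![1, 0, 0, 1, 1], ![0, 1, 0, 0, 0], ![0, 0, 1, 0, 0], ![0, 0, 0, 1, 0],
      ![0, 0, 0, 0, 1]]
    (by decide) (by decide) (by decide)

/-- The four leaves of `graphH` are pairwise orthogonal; were they to span the space, the inner
product of the two inner vertices, expanded along them, would vanish. -/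
theorem five_le_of_hasFOR_compl_graphH {d : ℕ} (h : HasFOR graphHᶜ d) : 5 ≤ d := by
  obtain ⟨φ, hφ⟩ := h
  obtain ⟨x, hx, hadj⟩ := hφ.exists_unit_vectors
  by_contra! hd
  have hleaf : Function.Injective (![2, 3, 4, 5] : Fin 4 → Fin 6) := by decide
  have hon : Orthonormal ℂ (x ∘ ![2, 3, 4, 5]) := by
    refine ⟨fun i => hx _, fun i j hij => (hadj _ _ (hleaf.ne hij)).1 ?_⟩
    revert i j
    decide
  have hspan := hon.linearIndependent.span_eq_top_of_card_eq_finrank' <| by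
    have := hon.linearIndependent.fintype_card_le_finrank
    simp only [Fintype.card_fin, finrank_euclideanSpace] at this ⊢
    omega
  have h01 : inner ℂ (x 0) (x 1) = 0 := by
    rw [← (OrthonormalBasis.mk hon hspan.ge).sum_inner_mul_inner]
    simp [Fin.sum_univ_four, (hadj 2 1 (by decide)).1 (by decide),
      (hadj 3 1 (by decide)).1 (by decide), (hadj 0 4 (by decide)).1 (by decide),
      (hadj 0 5 (by decide)).1 (by decide)]
  exact absurd ((hadj 0 1 (by decide)).2 h01) (by decide)

/-- The complement `H̄` of the 6-vertex graph `H = P₂^{2,2}` satisfies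
`Ξ(H̄) = 5`: it admits a faithful orthogonal representation in `ℂ⁵` but none in `ℂ⁴`. -/
theorem stmt17 : Xi graphHᶜ = 5 ∧ HasFOR graphHᶜ 5 ∧ ¬ HasFOR graphHᶜ 4 := by
  refine ⟨le_antisymm (Nat.sInf_le hasFOR_compl_graphH) ?_, hasFOR_compl_graphH, fun h => ?_⟩
  · exact le_csInf ⟨5, hasFOR_compl_graphH⟩ fun d hd => five_le_of_hasFOR_compl_graphH hd
  · exact absurd (five_le_of_hasFOR_compl_graphH h) (by decide)
end
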